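/- arXiv:1512.08946 — 3 statements merged into one kernel-verified Lean document; each statement's English description precedes it below -/
import Mathlib

section
/- For a euclidean lattice E of rank n and any t, r > 0, Σ_{v∈E, ‖v‖ < r} e^{-πt‖v‖²} ≥ (1 − n/(2πtr²)) · Σ_{v∈E} e^{-πt‖v‖²}. -/
open scoped Real

lemma aux_amgm (a b : ENNReal) : 2 * (a * b) ≤ a * a + b * b := by
  rcases eq_or_ne a ⊤ with rfl | ha
  · simp
  rcases eq_or_ne b ⊤ with rfl | hb
  · simp
  lift a to NNReal using ha
  lift b to NNReal using hb
  norm_cast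
  have : 2 * ((a:ℝ) * b) ≤ a * a + b * b := by nlinarith [sq_nonneg ((a:ℝ) - b)]
  exact_mod_cast this

section
variable {n : ℕ} (L : Submodule ℤ (EuclideanSpace ℝ (Fin n)))

abbrev LQ := L ⧸ (zmultiplesHom (L →+ L) (AddMonoidHom.id L) 2).range

lemma exists_equiv : ∃ e : (LQ L) × L ≃ L, ∀ q v, e (q, v) = q.out + (2:ℤ) • v := by
  refine ⟨Equiv.ofBijective (fun p => p.1.out + (2:ℤ) • p.2) ⟨?_, ?_⟩, fun q v => rfl⟩
  · rintro ⟨q, v⟩ ⟨q', v'⟩ h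
    simp only at h
    have key : ∀ (q : LQ L) (v : L), (QuotientAddGroup.mk (q.out + (2:ℤ) • v) : LQ L) = q := by
      intro q v
      rw [QuotientAddGroup.mk_add_of_mem]
      · exact Quotient.out_eq' q
      · exact ⟨v, by simp⟩
    have hq : q = q' := by rw [← key q v, h, key]
    subst hq
    have h2 : (2:ℤ) • v = (2:ℤ) • v' := add_left_cancel h
    have h3 := congrArg (Subtype.val) h2
    simp only [two_smul, Submodule.coe_add] at h3
    rw [← two_smul ℝ, ← two_smul ℝ (v' : EuclideanSpace ℝ (Fin n))] at h3
    have h4 : v = v' := Subtype.ext (smul_right_injective _ (two_ne_zero (α := ℝ)) h3)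
    rw [h4]
  · intro d
    have : (QuotientAddGroup.mk ((QuotientAddGroup.mk d : LQ L).out) : LQ L) = QuotientAddGroup.mk d :=
      Quotient.out_eq' _
    rw [QuotientAddGroup.eq] at this
    obtain ⟨v, hv⟩ := this
    refine ⟨(QuotientAddGroup.mk d, v), ?_⟩
    have hv' : (2:ℤ) • v = -((QuotientAddGroup.mk d : LQ L).out) + d := by rw [← hv]; simp
    simp only [hv']; abel

noncomputable def PP (φ : L → ENNReal) (d : L) : ENNReal := ∑' v : L, φ (d + (2:ℤ) • v)

lemma double_sum (φ ψ : L → ENNReal) :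
    ∑' v : L, ∑' w : L, φ (v + w) * ψ (v - w) = ∑' q : LQ L, PP L φ q.out * PP L ψ q.out := by
  obtain ⟨e, he⟩ := exists_equiv L
  have hper : ∀ d v : L, PP L φ (d + (2:ℤ) • v) = PP L φ d := by
    intro d v
    unfold PP
    rw [← (Equiv.addLeft v).tsum_eq (fun w => φ (d + (2:ℤ) • w))]
    simp [add_assoc]
  calc ∑' v : L, ∑' w : L, φ (v + w) * ψ (v - w)
      = ∑' w : L, ∑' v : L, φ (v + w) * ψ (v - w) := ENNReal.tsum_comm
    _ = ∑' w : L, ∑' d : L, φ (d + (2:ℤ) • w) * ψ d := by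
        refine tsum_congr fun w => ?_
        rw [← (Equiv.addRight w).tsum_eq (fun v => φ (v + w) * ψ (v - w))]
        refine tsum_congr fun d => ?_
        simp [two_smul, add_assoc]
    _ = ∑' d : L, ∑' w : L, φ (d + (2:ℤ) • w) * ψ d := ENNReal.tsum_comm
    _ = ∑' d : L, PP L φ d * ψ d := by
        refine tsum_congr fun d => ?_
        rw [ENNReal.tsum_mul_right]; rfl
    _ = ∑' p : LQ L × L, PP L φ (e p) * ψ (e p) := (e.tsum_eq (fun d => PP L φ d * ψ d)).symm
    _ = ∑' q : LQ L, ∑' v : L, PP L φ (e (q, v)) * ψ (e (q, v)) :=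
        ENNReal.tsum_prod (f := fun q v => PP L φ (e (q, v)) * ψ (e (q, v)))
    _ = _ := by
        refine tsum_congr fun q => ?_
        simp only [he, hper, ENNReal.tsum_mul_left]; rfl

noncomputable def FE (a : ℝ) (x : EuclideanSpace ℝ (Fin n)) : ENNReal :=
  ∑' v : L, ENNReal.ofReal (Real.exp (-a * ‖(v : EuclideanSpace ℝ (Fin n)) - x‖ ^ 2))

lemma FE_mul (a : ℝ) (x y : EuclideanSpace ℝ (Fin n)) :
    FE L a x * FE L a y = ∑' q : LQ L,
      PP L (fun v => ENNReal.ofReal (Real.exp (-(a/2) * ‖(v : EuclideanSpace ℝ (Fin n)) - (x + y)‖ ^ 2))) q.out *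
      PP L (fun v => ENNReal.ofReal (Real.exp (-(a/2) * ‖(v : EuclideanSpace ℝ (Fin n)) - (x - y)‖ ^ 2))) q.out := by
  rw [← double_sum]
  unfold FE
  rw [← ENNReal.tsum_mul_right]
  refine tsum_congr fun v => ?_
  rw [← ENNReal.tsum_mul_left]
  refine tsum_congr fun w => ?_
  rw [← ENNReal.ofReal_mul (by positivity), ← ENNReal.ofReal_mul (by positivity), ← Real.exp_add, ← Real.exp_add]
  congr 2
  have h := parallelogram_law_with_norm ℝ ((v : EuclideanSpace ℝ (Fin n)) - x) ((w : EuclideanSpace ℝ (Fin n)) - y)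
  have h1 : ((v + w : L) : EuclideanSpace ℝ (Fin n)) - (x + y) = (v - x) + (w - y) := by
    push_cast; abel
  have h2 : ((v - w : L) : EuclideanSpace ℝ (Fin n)) - (x - y) = (v - x) - (w - y) := by
    push_cast; abel
  rw [h1, h2]
  linear_combination (a/2) * h

lemma FE_ineq (a : ℝ) (x : EuclideanSpace ℝ (Fin n)) :
    2 * (FE L a x * FE L a x) ≤ FE L a (x + x) * FE L a 0 + FE L a 0 * FE L a 0 := by
  rw [FE_mul, FE_mul, FE_mul, ← ENNReal.tsum_add, ← ENNReal.tsum_mul_left]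
  simp only [add_zero, sub_zero, sub_self]
  exact ENNReal.tsum_le_tsum fun q => aux_amgm _ _

lemma FE_per (a : ℝ) (x : EuclideanSpace ℝ (Fin n)) (w : L) : FE L a (x + w) = FE L a x := by
  unfold FE
  rw [← (Equiv.addRight w).tsum_eq]
  simp

variable [DiscreteTopology L]

lemma summ0 (a : ℝ) (ha : 0 < a) :
    Summable fun v : L => Real.exp (-a * ‖(v : EuclideanSpace ℝ (Fin n))‖ ^ 2) := by
  classical
  set k := Module.finrank ℤ L + 1 with hk
  have h1 := (ZLattice.summable_norm_pow_inv L (2 * k) (by omega)).mul_left ((k.factorial : ℝ) / a ^ k)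
  have h2 : Summable (fun v : L => if v = 0 then (1:ℝ) else 0) :=
    summable_of_ne_finset_zero (s := {0}) (by simp +contextual)
  refine Summable.of_nonneg_of_le (fun _ => by positivity) (fun v => ?_) (h1.add h2)
  by_cases hv : v = 0
  · subst hv; simp
  · simp only [hv, if_false, add_zero]
    have hv' : 0 < ‖(v : EuclideanSpace ℝ (Fin n))‖ := by simpa using hv
    have := Real.pow_div_factorial_le_exp (a * ‖(v : EuclideanSpace ℝ (Fin n))‖ ^ 2) (by positivity) k
    rw [neg_mul, Real.exp_neg]
    refine (inv_anti₀ (by positivity) this).trans (le_of_eq ?_)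
    rw [mul_pow, ← pow_mul]
    simp
    field_simp

lemma FE_ball (a : ℝ) (ha : 0 < a) (D : ℝ) (x : EuclideanSpace ℝ (Fin n)) (hx : ‖x‖ ≤ D) :
    FE L a x ≤ ENNReal.ofReal (Real.exp (a * D ^ 2)) * FE L (a/2) 0 := by
  unfold FE
  rw [← ENNReal.tsum_mul_left]
  refine ENNReal.tsum_le_tsum fun v => ?_
  rw [← ENNReal.ofReal_mul (by positivity), ← Real.exp_add]
  refine ENNReal.ofReal_le_ofReal (Real.exp_le_exp.2 ?_)
  rw [sub_zero]
  have h1 : ‖(v : EuclideanSpace ℝ (Fin n))‖ ≤ ‖(v : EuclideanSpace ℝ (Fin n)) - x‖ + ‖x‖ := by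
    simpa using norm_add_le ((v : EuclideanSpace ℝ (Fin n)) - x) x
  have h2 : ‖(v : EuclideanSpace ℝ (Fin n))‖ ^ 2 ≤ 2 * ‖(v : EuclideanSpace ℝ (Fin n)) - x‖ ^ 2 + 2 * D ^ 2 := by
    have h3 := pow_le_pow_left₀ (norm_nonneg _) (h1.trans (add_le_add_right hx _)) 2
    nlinarith [sq_nonneg (‖(v : EuclideanSpace ℝ (Fin n)) - x‖ - D)]
  nlinarith

lemma FE_zero_ne_top (a : ℝ) (ha : 0 < a) : FE L a 0 ≠ ⊤ := by
  unfold FE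
  simpa using (summ0 L a ha).tsum_ofReal_ne_top

variable [IsZLattice ℝ L]

lemma exists_bound : ∃ D : ℝ, ∀ x : EuclideanSpace ℝ (Fin n), ∃ w : L, ‖x - w‖ ≤ D := by
  have : Module.Free ℤ L := ZLattice.module_free ℝ L
  have : Module.Finite ℤ L := ZLattice.module_finite ℝ L
  let b := Module.Free.chooseBasis ℤ L
  let B := b.ofZLatticeBasis ℝ L
  refine ⟨∑ i, ‖B i‖, fun x => ?_⟩
  have hm := (ZSpan.floor B x).2
  have hs : Submodule.span ℤ (Set.range B) = L := b.ofZLatticeBasis_span ℝ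
  replace hm := hs.le hm
  exact ⟨⟨_, hm⟩, ZSpan.norm_fract_le B x⟩

lemma FE_le (a : ℝ) (ha : 0 < a) (x : EuclideanSpace ℝ (Fin n)) : FE L a x ≤ FE L a 0 := by
  obtain ⟨D, hD⟩ := exists_bound L
  set C := ENNReal.ofReal (Real.exp (a * D ^ 2)) * FE L (a/2) 0
  have hC : C ≠ ⊤ := ENNReal.mul_ne_top (by simp) (FE_zero_ne_top L _ (by positivity))
  have hle : ∀ x, FE L a x ≤ C := by
    intro x
    obtain ⟨w, hw⟩ := hD x
    have := FE_per L a (x - w) w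
    rw [sub_add_cancel] at this
    rw [this]
    exact FE_ball L a ha D _ hw
  have hfin : ∀ x, FE L a x ≠ ⊤ := fun x => ne_top_of_le_ne_top hC (hle x)
  let f : EuclideanSpace ℝ (Fin n) → ℝ := fun x => (FE L a x).toReal
  have hbdd : BddAbove (Set.range f) := ⟨C.toReal, by
    rintro _ ⟨x, rfl⟩; exact ENNReal.toReal_mono hC (hle x)⟩
  have hf0 : ∀ x, 0 ≤ f x := fun x => ENNReal.toReal_nonneg
  have hf : ∀ x, 2 * (f x * f x) ≤ f (x + x) * f 0 + f 0 * f 0 := by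
    intro x
    have := ENNReal.toReal_mono (by finiteness [hfin (x+x), hfin 0]) (FE_ineq L a x)
    rw [ENNReal.toReal_add (by finiteness [hfin (x+x), hfin 0]) (by finiteness [hfin 0])] at this
    simpa [ENNReal.toReal_mul] using this
  set M := ⨆ x, f x
  have hM : ∀ x, f x ≤ M := fun x => le_ciSup hbdd x
  have h0 := hf0 0
  have hMle : M ≤ f 0 := by
    by_contra! hlt
    have h1 : ∀ x, f x ≤ √((M * f 0 + f 0 * f 0) / 2) := by
      intro x
      apply Real.le_sqrt_of_sq_le
      nlinarith [hf x, mul_le_mul_of_nonneg_right (hM (x + x)) h0]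
    have h2 := ciSup_le h1
    have h3 : M ^ 2 ≤ (M * f 0 + f 0 * f 0) / 2 := by
      rw [← Real.sq_sqrt (show 0 ≤ (M * f 0 + f 0 * f 0) / 2 by nlinarith)]
      exact pow_le_pow_left₀ (by linarith) h2 2
    nlinarith
  exact (ENNReal.toReal_le_toReal (hfin x) (hfin 0)).1 ((hM x).trans hMle)

lemma FE_real (a : ℝ) (ha : 0 < a) (x : EuclideanSpace ℝ (Fin n)) :
    Summable (fun v : L => Real.exp (-a * ‖(v : EuclideanSpace ℝ (Fin n)) - x‖ ^ 2)) ∧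
    ∑' v : L, Real.exp (-a * ‖(v : EuclideanSpace ℝ (Fin n)) - x‖ ^ 2) ≤
    ∑' v : L, Real.exp (-a * ‖(v : EuclideanSpace ℝ (Fin n))‖ ^ 2) := by
  have h := FE_le L a ha x
  have h0 := FE_zero_ne_top L a ha
  have hx := ne_top_of_le_ne_top h0 h
  have hs : Summable (fun v : L => Real.exp (-a * ‖(v : EuclideanSpace ℝ (Fin n)) - x‖ ^ 2)) := by
    have := ENNReal.summable_toReal hx
    refine this.congr fun v => ?_
    rw [ENNReal.toReal_ofReal (by positivity)]
  refine ⟨hs, ?_⟩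
  unfold FE at h
  simp only [sub_zero] at h
  rw [← ENNReal.ofReal_tsum_of_nonneg (fun _ => by positivity) hs,
    ← ENNReal.ofReal_tsum_of_nonneg (fun _ => by positivity) (summ0 L a ha)] at h
  exact (ENNReal.ofReal_le_ofReal_iff (tsum_nonneg fun _ => by positivity)).1 h

lemma aux_cosh (u : ℝ) : 2 + u ^ 2 ≤ Real.exp u + Real.exp (-u) := by
  have key : ∀ u : ℝ, 0 ≤ u → 2 + u ^ 2 ≤ Real.exp u + Real.exp (-u) := by
    intro u hu
    have h1 : u / 2 ≤ Real.sinh (u / 2) := Real.self_le_sinh_iff.2 (by positivity)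
    have h2 := Real.sinh_eq (u / 2)
    have e1 : Real.exp u = Real.exp (u/2) ^ 2 := by rw [← Real.exp_nat_mul]; congr 1; push_cast; ring
    have e2 : Real.exp (-u) = Real.exp (-(u/2)) ^ 2 := by
      rw [← Real.exp_nat_mul]; congr 1; push_cast; ring
    have e3 : Real.exp (u/2) * Real.exp (-(u/2)) = 1 := by rw [← Real.exp_add]; simp
    rw [e1, e2]
    have h4 : u ≤ Real.exp (u/2) - Real.exp (-(u/2)) := by linarith
    nlinarith [pow_le_pow_left₀ hu h4 2]
  rcases le_total 0 u with h | h
  · exact key u h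
  · have := key (-u) (by linarith)
    rw [neg_neg] at this
    linarith [neg_sq u]

lemma summ2 (a : ℝ) (ha : 0 < a) :
    Summable fun v : L => ‖(v : EuclideanSpace ℝ (Fin n))‖ ^ 2 *
      Real.exp (-a * ‖(v : EuclideanSpace ℝ (Fin n))‖ ^ 2) := by
  refine Summable.of_nonneg_of_le (fun _ => by positivity) (fun v => ?_)
    ((summ0 L (a/2) (by positivity)).mul_left (2/a))
  set y := ‖(v : EuclideanSpace ℝ (Fin n))‖ ^ 2
  have h1 : a / 2 * y ≤ Real.exp (a / 2 * y) := by linarith [Real.add_one_le_exp (a / 2 * y)]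
  have h2 : Real.exp (-(a/2) * y) = Real.exp (a/2*y) * Real.exp (-a * y) := by
    rw [← Real.exp_add]; congr 1; ring
  rw [h2, ← mul_assoc]
  gcongr
  rw [div_mul_eq_mul_div, le_div_iff₀ ha]
  linarith

lemma dir_bound (a : ℝ) (ha : 0 < a) (i : Fin n) :
    Summable (fun v : L => ((v : EuclideanSpace ℝ (Fin n)) i) ^ 2 *
        Real.exp (-a * ‖(v : EuclideanSpace ℝ (Fin n))‖ ^ 2)) ∧
    2 * a * ∑' v : L, ((v : EuclideanSpace ℝ (Fin n)) i) ^ 2 *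
        Real.exp (-a * ‖(v : EuclideanSpace ℝ (Fin n))‖ ^ 2) ≤
      ∑' v : L, Real.exp (-a * ‖(v : EuclideanSpace ℝ (Fin n))‖ ^ 2) := by
  have hs : Summable (fun v : L => ((v : EuclideanSpace ℝ (Fin n)) i) ^ 2 *
        Real.exp (-a * ‖(v : EuclideanSpace ℝ (Fin n))‖ ^ 2)) := by
    refine Summable.of_nonneg_of_le (fun _ => by positivity) (fun v => ?_) (summ2 L a ha)
    gcongr ?_ * _
    rw [← sq_abs]
    gcongr
    exact PiLp.norm_apply_le (v : EuclideanSpace ℝ (Fin n)) i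
  refine ⟨hs, ?_⟩
  have h0 := summ0 L a ha
  set S := ∑' v : L, ((v : EuclideanSpace ℝ (Fin n)) i) ^ 2 *
        Real.exp (-a * ‖(v : EuclideanSpace ℝ (Fin n))‖ ^ 2) with hS
  set G := ∑' v : L, Real.exp (-a * ‖(v : EuclideanSpace ℝ (Fin n))‖ ^ 2) with hG
  have hG0 : 0 ≤ G := tsum_nonneg fun _ => by positivity
  have main : ∀ ε : ℝ, G + 2 * a ^ 2 * ε ^ 2 * S ≤ Real.exp (a * ε ^ 2) * G := by
    intro ε
    let x : EuclideanSpace ℝ (Fin n) := EuclideanSpace.single i ε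
    have hx : ‖x‖ ^ 2 = ε ^ 2 := by simp [x]
    obtain ⟨s1, l1⟩ := FE_real L a ha x
    obtain ⟨s2, l2⟩ := FE_real L a ha (-x)
    have hpt : ∀ v : L, 2 * Real.exp (-a * ‖(v : EuclideanSpace ℝ (Fin n))‖ ^ 2) +
        4 * a ^ 2 * ε ^ 2 * (((v : EuclideanSpace ℝ (Fin n)) i) ^ 2 *
        Real.exp (-a * ‖(v : EuclideanSpace ℝ (Fin n))‖ ^ 2)) ≤
        Real.exp (a * ε ^ 2) * (Real.exp (-a * ‖(v : EuclideanSpace ℝ (Fin n)) - x‖ ^ 2) +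
          Real.exp (-a * ‖(v : EuclideanSpace ℝ (Fin n)) - -x‖ ^ 2)) := by
      intro v
      have hin : inner ℝ (v : EuclideanSpace ℝ (Fin n)) x = ε * (v : EuclideanSpace ℝ (Fin n)) i := by
        simp [x, EuclideanSpace.inner_single_right]
      have n1 := norm_sub_sq_real (v : EuclideanSpace ℝ (Fin n)) x
      have n2 := norm_add_sq_real (v : EuclideanSpace ℝ (Fin n)) x
      rw [hin, hx] at n1 n2
      rw [sub_neg_eq_add, n1, n2, mul_add, ← Real.exp_add, ← Real.exp_add]
      set c := (v : EuclideanSpace ℝ (Fin n)) i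
      set N := ‖(v : EuclideanSpace ℝ (Fin n))‖ ^ 2
      have e1 : Real.exp (a * ε ^ 2 + -a * (N - 2 * (ε * c) + ε ^ 2)) =
          Real.exp (-a * N) * Real.exp (2 * a * ε * c) := by
        rw [← Real.exp_add]; congr 1; ring
      have e2 : Real.exp (a * ε ^ 2 + -a * (N + 2 * (ε * c) + ε ^ 2)) =
          Real.exp (-a * N) * Real.exp (-(2 * a * ε * c)) := by
        rw [← Real.exp_add]; congr 1; ring
      rw [e1, e2]
      nlinarith [mul_le_mul_of_nonneg_left (aux_cosh (2 * a * ε * c)) (Real.exp_pos (-a * N)).le]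
    have hsum := Summable.tsum_le_tsum hpt ((h0.mul_left 2).add (hs.mul_left _))
      ((s1.add s2).mul_left _)
    rw [(h0.mul_left 2).tsum_add (hs.mul_left _), tsum_mul_left, tsum_mul_left, tsum_mul_left,
      s1.tsum_add s2] at hsum
    have := mul_le_mul_of_nonneg_left (add_le_add l1 l2) (Real.exp_pos (a * ε ^ 2)).le
    linarith
  have main2 : ∀ s : ℝ, 0 < s → s ≤ 1 → 2 * a * S ≤ G + s * G := by
    intro s hs0 hs1
    have hm := main (√(s / a))
    rw [Real.sq_sqrt (by positivity)] at hm
    have e : a * (s / a) = s := by field_simp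
    have e' : 2 * a ^ 2 * (s / a) * S = s * (2 * a * S) := by field_simp
    rw [e, e'] at hm
    have hexp : Real.exp s ≤ 1 + s + s ^ 2 := by
      have := Real.abs_exp_sub_one_sub_id_le (x := s) (by rw [abs_of_pos hs0]; exact hs1)
      linarith [le_abs_self (Real.exp s - 1 - s)]
    have := mul_le_mul_of_nonneg_right hexp hG0
    have h3 : s * (2 * a * S) ≤ s * (G + s * G) := by nlinarith
    exact le_of_mul_le_mul_left h3 hs0
  refine le_of_forall_pos_le_add fun δ hδ => ?_
  have hp : 0 < δ / (G + 1) := by positivity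
  have h1 := main2 (min 1 (δ / (G + 1))) (lt_min one_pos hp) (min_le_left _ _)
  have h2 : min 1 (δ / (G + 1)) * G ≤ δ := by
    calc min 1 (δ / (G + 1)) * G ≤ δ / (G + 1) * (G + 1) := by
          gcongr
          · exact min_le_right _ _
          · linarith
      _ = δ := by field_simp
  linarith

lemma second_moment (a : ℝ) (ha : 0 < a) :
    2 * a * ∑' v : L, ‖(v : EuclideanSpace ℝ (Fin n))‖ ^ 2 *
        Real.exp (-a * ‖(v : EuclideanSpace ℝ (Fin n))‖ ^ 2) ≤
      n * ∑' v : L, Real.exp (-a * ‖(v : EuclideanSpace ℝ (Fin n))‖ ^ 2) := by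
  have h : ∀ v : L, ‖(v : EuclideanSpace ℝ (Fin n))‖ ^ 2 *
        Real.exp (-a * ‖(v : EuclideanSpace ℝ (Fin n))‖ ^ 2) =
      ∑ i, ((v : EuclideanSpace ℝ (Fin n)) i) ^ 2 *
        Real.exp (-a * ‖(v : EuclideanSpace ℝ (Fin n))‖ ^ 2) := by
    intro v
    rw [← Finset.sum_mul, ← EuclideanSpace.real_norm_sq_eq]
  rw [tsum_congr h, Summable.tsum_finsetSum (fun i _ => (dir_bound L a ha i).1), Finset.mul_sum]
  refine (Finset.sum_le_sum fun i _ => (dir_bound L a ha i).2).trans (le_of_eq ?_)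
  simp

end


/-- For a euclidean lattice `E` of rank `n` and any `t, r > 0`,
`Σ_{v∈E, ‖v‖<r} e^{-πt‖v‖²} ≥ (1 − n/(2πtr²)) · Σ_{v∈E} e^{-πt‖v‖²}`. -/
theorem gaussian_mass_ball_lower_bound {n : ℕ}
    (L : Submodule ℤ (EuclideanSpace ℝ (Fin n)))
    [DiscreteTopology L] [IsZLattice ℝ L]
    (t r : ℝ) (ht : 0 < t) (hr : 0 < r) :
    (1 - (n : ℝ) / (2 * π * t * r ^ 2)) *
        ∑' v : L, Real.exp (-π * t * ‖(v : EuclideanSpace ℝ (Fin n))‖ ^ 2) ≤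
      ∑' v : L, (if ‖(v : EuclideanSpace ℝ (Fin n))‖ < r then
          Real.exp (-π * t * ‖(v : EuclideanSpace ℝ (Fin n))‖ ^ 2) else 0) := by
  have ha : 0 < π * t := by positivity
  have h2 := second_moment L (π * t) ha
  have s0 := summ0 L (π * t) ha
  have s2 := summ2 L (π * t) ha
  simp only [← neg_mul] at h2 s0 s2
  have hs : Summable (fun v : L => if ‖(v : EuclideanSpace ℝ (Fin n))‖ < r then
          Real.exp (-π * t * ‖(v : EuclideanSpace ℝ (Fin n))‖ ^ 2) else 0) := by
    refine Summable.of_nonneg_of_le (fun v => ?_) (fun v => ?_) s0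
    · split_ifs <;> positivity
    · split_ifs
      · exact le_rfl
      · positivity
  have hle := Summable.tsum_le_tsum (f := fun v : L =>
      Real.exp (-π * t * ‖(v : EuclideanSpace ℝ (Fin n))‖ ^ 2)) (fun v => ?_) s0
      (hs.add (s2.mul_left (1 / r ^ 2)))
  · rw [hs.tsum_add (s2.mul_left _), tsum_mul_left] at hle
    set G := ∑' v : L, Real.exp (-π * t * ‖(v : EuclideanSpace ℝ (Fin n))‖ ^ 2)
    set S := ∑' v : L, ‖(v : EuclideanSpace ℝ (Fin n))‖ ^ 2 *
      Real.exp (-π * t * ‖(v : EuclideanSpace ℝ (Fin n))‖ ^ 2)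
    have h3 : 1 / r ^ 2 * S ≤ n / (2 * π * t * r ^ 2) * G := by
      rw [div_mul_eq_mul_div, div_mul_eq_mul_div, div_le_div_iff₀ (by positivity) (by positivity)]
      nlinarith [mul_le_mul_of_nonneg_right h2 (sq_nonneg r)]
    linarith
  · split_ifs with h
    · simp only [le_add_iff_nonneg_right]; positivity
    · rw [zero_add, ← mul_assoc]
      refine le_mul_of_one_le_left (by positivity) ?_
      rw [div_mul_eq_mul_div, one_mul, one_le_div (by positivity)]
      push Not at h
      exact pow_le_pow_left₀ hr.le h 2
end

section
/- For any euclidean lattice E of positive rank n, h⁰_θ(E) − (n/2) log n + log(1 − 1/(2π)) ≤ log |{v ∈ E : ‖v‖ ≤ 1}| ≤ h⁰_θ(E) + π. -/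
open scoped Real

lemma aux_posdef {G : Type*} [AddCommGroup G] (h2 : ∀ a : G, a + a = 0 → a = 0)
    (D : G → ℝ) (hD : Summable D) :
    Summable (fun p : G × G => D (p.1 + p.2) * D (p.1 - p.2)) ∧
    0 ≤ ∑' p : G × G, D (p.1 + p.2) * D (p.1 - p.2) := by
  have hDn : Summable (fun a => ‖D a‖) := hD.norm
  have hprod : Summable (fun p : G × G => D p.1 * D p.2) :=
    summable_mul_of_summable_norm hDn hDn
  have hs1 : Summable (fun p : G × G => D (p.1 + p.2) * D (p.1 - p.2)) := by
    refine hprod.comp_injective (i := fun p : G × G => (p.1 + p.2, p.1 - p.2)) ?_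
    rintro ⟨a, b⟩ ⟨a', b'⟩ h
    simp only [Prod.mk.injEq] at h
    have hb : a - a' = 0 := by
      apply h2
      have h1 : a - a' = b' - b := by
        rw [sub_eq_sub_iff_add_eq_add, h.1, add_comm]
      have h3 : a - a' = b - b' := by
        have := h.2
        rw [sub_eq_sub_iff_add_eq_add] at this
        rw [sub_eq_sub_iff_add_eq_add, this, add_comm]
      nth_rewrite 1 [h1]; rw [h3]; abel
    have : a = a' := sub_eq_zero.mp hb
    subst this
    simpa using h
  refine ⟨hs1, ?_⟩
  let H : AddSubgroup G := (AddMonoidHom.id G + AddMonoidHom.id G).range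
  let d : G ≃ H := Equiv.ofBijective (fun w => ⟨w + w, w, rfl⟩) ⟨by
      intro a b hab
      have : a + a = b + b := congrArg Subtype.val hab
      refine sub_eq_zero.mp (h2 _ ?_)
      rw [show a - b + (a - b) = (a + a) - (b + b) by abel, this, sub_self], by
      rintro ⟨_, w, rfl⟩
      exact ⟨w, rfl⟩⟩
  let e : (G ⧸ H) × H ≃ G := Equiv.ofBijective (fun q => q.1.out + q.2) ⟨by
      rintro ⟨q, h⟩ ⟨q', h'⟩ hh
      simp only at hh
      have : q = q' := by
        rw [← QuotientAddGroup.out_eq' q, ← QuotientAddGroup.out_eq' q', QuotientAddGroup.eq]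
        have : -q.out + q'.out = (h - h' : H) := by
          push_cast
          rw [eq_sub_iff_add_eq, add_assoc, ← hh]; abel
        rw [this]; exact Subtype.mem _
      subst this
      simpa using hh, by
      intro g
      refine ⟨((g : G ⧸ H), ⟨-(g : G ⧸ H).out + g, ?_⟩), by simp⟩
      rw [← QuotientAddGroup.eq, QuotientAddGroup.out_eq']⟩
  -- reparametrise by ((q, h), k) with p1 - p2 = q + h, p1 + p2 = q + k
  let F : ((G ⧸ H) × (H × H)) ≃ G × G :=
    { toFun := fun z => (z.1.out + z.2.1 + d.symm (z.2.2 - z.2.1), d.symm (z.2.2 - z.2.1))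
      invFun := fun p => ((e.symm (p.1 - p.2)).1, ((e.symm (p.1 - p.2)).2,
          (e.symm (p.1 - p.2)).2 + d p.2))
      left_inv := by
        rintro ⟨q, h, k⟩
        have : e.symm (q.out + h) = (q, h) := by
          rw [Equiv.symm_apply_eq]; rfl
        simp [this]
      right_inv := by
        rintro ⟨a, b⟩
        have : (e.symm (a - b)).1.out + ((e.symm (a - b)).2 : G) = a - b :=
          e.apply_symm_apply (a - b)
        simp [this] }
  have hF : ∀ z, D ((F z).1 + (F z).2) * D ((F z).1 - (F z).2)
      = D (z.1.out + z.2.2) * D (z.1.out + z.2.1) := by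
    rintro ⟨q, h, k⟩
    have hd : ((d.symm (k - h) : G) + d.symm (k - h)) = ((k - h : H) : G) :=
      congrArg Subtype.val (d.apply_symm_apply (k - h))
    simp only [F, Equiv.coe_fn_mk]
    rw [add_assoc _ (d.symm (k - h)), hd, add_sub_cancel_right]
    congr 2
    push_cast; abel
  rw [← F.tsum_eq]
  simp_rw [hF]
  have hsF : Summable fun z : (G ⧸ H) × (H × H) =>
      D (z.1.out + z.2.2) * D (z.1.out + z.2.1) := by
    have := F.summable_iff.mpr hs1
    refine this.congr fun z => ?_
    simpa using (hF z)
  rw [hsF.tsum_prod]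
  refine tsum_nonneg fun q => ?_
  have hq : Summable fun h : H => D (q.out + h) := by
    refine hD.comp_injective (i := fun h : H => q.out + (h : G)) ?_
    intro a b hab
    simpa using hab
  have : ∑' c : H × H, D (q.out + c.2) * D (q.out + c.1)
      = (∑' h : H, D (q.out + h)) * (∑' h : H, D (q.out + h)) := by
    rw [tsum_mul_tsum_of_summable_norm hq.norm hq.norm]
    exact tsum_congr fun c => mul_comm _ _
  rw [this]
  exact mul_self_nonneg _

set_option linter.unusedSectionVars false

section
variable {n : ℕ} (L : Submodule ℤ (EuclideanSpace ℝ (Fin n)))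
    [DiscreteTopology L] [IsZLattice ℝ L]

lemma aux_summable0 {c : ℝ} (hc : 0 < c) :
    Summable fun v : L => Real.exp (-c * ‖(v : EuclideanSpace ℝ (Fin n))‖ ^ 2) := by
  set k := Module.finrank ℤ L + 1 with hk
  have h1 := (ZLattice.summable_norm_pow_inv L (2 * k) (by omega)).mul_left
    ((k.factorial : ℝ) / c ^ k)
  refine Summable.of_norm_bounded_eventually h1 ?_
  have : ∀ᶠ v : L in Filter.cofinite, v ≠ 0 := by
    simp [Filter.eventually_cofinite]
  filter_upwards [this] with v hv
  have hv' : 0 < ‖v‖ := norm_pos_iff.mpr hv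
  have h2 := Real.pow_div_factorial_le_exp (x := c * ‖v‖ ^ 2) (by positivity) k
  rw [Real.norm_eq_abs, abs_of_pos (Real.exp_pos _), neg_mul, Real.exp_neg]
  rw [← Submodule.coe_norm] at *
  have h3 : (k.factorial : ℝ) / c ^ k * ‖v‖⁻¹ ^ (2 * k)
      = ((c * ‖v‖ ^ 2) ^ k / k.factorial)⁻¹ := by
    rw [mul_pow, ← pow_mul, inv_pow]; field_simp
  rw [h3]
  exact inv_anti₀ (by positivity) h2

lemma aux_shift {c : ℝ} (hc : 0 < c) (x v : EuclideanSpace ℝ (Fin n)) :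
    Real.exp (-c * ‖v - x‖ ^ 2) ≤ Real.exp (c * ‖x‖ ^ 2) * Real.exp (-(c / 2) * ‖v‖ ^ 2) := by
  rw [← Real.exp_add, Real.exp_le_exp]
  have h1 : ‖v‖ ≤ ‖v - x‖ + ‖x‖ := by simpa using norm_add_le (v - x) x
  have h2 : ‖v‖ ^ 2 ≤ 2 * ‖v - x‖ ^ 2 + 2 * ‖x‖ ^ 2 := by
    nlinarith [sq_nonneg (‖v - x‖ - ‖x‖), norm_nonneg v, norm_nonneg (v - x), norm_nonneg x]
  nlinarith

lemma aux_summable {c : ℝ} (hc : 0 < c) (x : EuclideanSpace ℝ (Fin n)) :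
    Summable fun v : L => Real.exp (-c * ‖(v : EuclideanSpace ℝ (Fin n)) - x‖ ^ 2) :=
  Summable.of_nonneg_of_le (fun _ => (Real.exp_pos _).le) (fun v => aux_shift hc x v)
    ((aux_summable0 L (half_pos hc)).mul_left _)

noncomputable def auxTh (c : ℝ) (x : EuclideanSpace ℝ (Fin n)) : ℝ :=
  ∑' v : L, Real.exp (-c * ‖(v : EuclideanSpace ℝ (Fin n)) - x‖ ^ 2)

lemma auxTh_neg (c : ℝ) (x : EuclideanSpace ℝ (Fin n)) : auxTh L c (-x) = auxTh L c x := by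
  unfold auxTh
  rw [← (Equiv.neg L).tsum_eq]
  refine tsum_congr fun v => ?_
  simp only [Equiv.neg_apply, Submodule.coe_neg]
  rw [← neg_add', norm_neg, ← sub_eq_add_neg]

lemma auxTh_bdd {c : ℝ} (hc : 0 < c) : BddAbove (Set.range (auxTh L c)) := by
  let b := Module.Free.chooseBasis ℤ L
  let B := b.ofZLatticeBasis ℝ L
  refine ⟨Real.exp (c * (∑ i, ‖B i‖) ^ 2) *
    ∑' v : L, Real.exp (-(c / 2) * ‖(v : EuclideanSpace ℝ (Fin n))‖ ^ 2), ?_⟩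
  rintro _ ⟨x, rfl⟩
  have hmem : (ZSpan.floor B x : EuclideanSpace ℝ (Fin n)) ∈ L := by
    exact (b.ofZLatticeBasis_span ℝ L).le (ZSpan.floor B x).2
  let w : L := ⟨_, hmem⟩
  have hx : auxTh L c x = auxTh L c (ZSpan.fract B x) := by
    unfold auxTh
    rw [← (Equiv.addRight w).tsum_eq]
    refine tsum_congr fun v => ?_
    simp only [Equiv.coe_addRight, Submodule.coe_add, ZSpan.fract_apply, w]
    congr 4; abel
  rw [hx]
  unfold auxTh
  rw [← tsum_mul_left]
  refine (aux_summable L hc _).tsum_le_tsum (fun v => (aux_shift hc _ _).trans ?_)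
    ((aux_summable0 L (half_pos hc)).mul_left _)
  gcongr
  exact ZSpan.norm_fract_le B x

lemma aux_par (a b y z : EuclideanSpace ℝ (Fin n)) (c : ℝ) :
    Real.exp (-(c/2) * ‖(a + b) - (y + z)‖ ^ 2) * Real.exp (-(c/2) * ‖(a - b) - (y - z)‖ ^ 2)
     = Real.exp (-c * ‖a - y‖ ^ 2) * Real.exp (-c * ‖b - z‖ ^ 2) := by
  rw [← Real.exp_add, ← Real.exp_add]
  congr 1
  have := parallelogram_law_with_norm ℝ (a - y) (b - z)
  rw [show (a + b) - (y + z) = (a - y) + (b - z) by abel,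
    show (a - b) - (y - z) = (a - y) - (b - z) by abel]
  linear_combination (-(c/2)) * this

lemma auxTh_mul {c : ℝ} (hc : 0 < c) (y z : EuclideanSpace ℝ (Fin n)) :
    HasSum (fun p : L × L =>
      Real.exp (-(c/2) * ‖((p.1 + p.2 : L) : EuclideanSpace ℝ (Fin n)) - (y + z)‖ ^ 2) *
      Real.exp (-(c/2) * ‖((p.1 - p.2 : L) : EuclideanSpace ℝ (Fin n)) - (y - z)‖ ^ 2))
      (auxTh L c y * auxTh L c z) := by
  have hs := summable_mul_of_summable_norm (aux_summable L hc y).norm (aux_summable L hc z).norm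
  have h := (aux_summable L hc y).hasSum.mul (aux_summable L hc z).hasSum hs
  have he : (fun p : L × L =>
      Real.exp (-(c/2) * ‖((p.1 + p.2 : L) : EuclideanSpace ℝ (Fin n)) - (y + z)‖ ^ 2) *
      Real.exp (-(c/2) * ‖((p.1 - p.2 : L) : EuclideanSpace ℝ (Fin n)) - (y - z)‖ ^ 2))
      = fun p : L × L => Real.exp (-c * ‖(p.1 : EuclideanSpace ℝ (Fin n)) - y‖ ^ 2) *
        Real.exp (-c * ‖(p.2 : EuclideanSpace ℝ (Fin n)) - z‖ ^ 2) :=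
    funext fun p => aux_par _ _ _ _ _
  rw [he]
  exact h

lemma auxTh_ineq {c : ℝ} (hc : 0 < c) (x : EuclideanSpace ℝ (Fin n)) :
    2 * auxTh L c x ^ 2 ≤ auxTh L c (x + x) * auxTh L c 0 + auxTh L c 0 ^ 2 := by
  have h := aux_posdef (G := L) (by
      intro a ha
      have h0 : (a : EuclideanSpace ℝ (Fin n)) + a = 0 := congrArg Subtype.val ha
      rw [← two_smul ℝ, smul_eq_zero] at h0
      exact Subtype.ext (h0.resolve_left two_ne_zero))
    (fun a : L => Real.exp (-(c/2) * ‖(a : EuclideanSpace ℝ (Fin n)) - (x + x)‖ ^ 2)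
      - Real.exp (-(c/2) * ‖(a : EuclideanSpace ℝ (Fin n)) - 0‖ ^ 2))
    ((aux_summable L (half_pos hc) _).sub (aux_summable L (half_pos hc) _))
  have h1 := auxTh_mul L hc (x + x) 0
  have h2 := auxTh_mul L hc x x
  have h3 := auxTh_mul L hc x (-x)
  have h4 := auxTh_mul L hc 0 0
  have hh := ((h1.sub h2).sub h3).add h4
  have := h.2
  have he := hh.tsum_eq
  rw [auxTh_neg] at he
  have h5 : 0 ≤ auxTh L c (x + x) * auxTh L c 0 - auxTh L c x * auxTh L c x
      - auxTh L c x * auxTh L c x + auxTh L c 0 * auxTh L c 0 := by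
    rw [← he]
    refine this.trans_eq (tsum_congr fun p => ?_)
    simp only [add_zero, sub_zero, sub_self, add_neg_cancel, sub_neg_eq_add]
    ring
  nlinarith

lemma auxTh_le {c : ℝ} (hc : 0 < c) (x : EuclideanSpace ℝ (Fin n)) :
    auxTh L c x ≤ auxTh L c 0 := by
  have hb := auxTh_bdd L hc
  set M := ⨆ y, auxTh L c y with hM
  have hle : ∀ y, auxTh L c y ≤ M := fun y => le_ciSup hb y
  have hpos : 0 < auxTh L c 0 :=
    (aux_summable L hc 0).tsum_pos (fun _ => (Real.exp_pos _).le) 0 (Real.exp_pos _)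
  have h1 : ∀ y, auxTh L c y ≤ √((M * auxTh L c 0 + auxTh L c 0 ^ 2) / 2) := by
    intro y
    apply Real.le_sqrt_of_sq_le
    have := auxTh_ineq L hc y
    nlinarith [hle (y + y)]
  have h2 : M ≤ √((M * auxTh L c 0 + auxTh L c 0 ^ 2) / 2) := ciSup_le h1
  have hM0 := hle 0
  have h3 : M ^ 2 ≤ (M * auxTh L c 0 + auxTh L c 0 ^ 2) / 2 := by
    rwa [Real.le_sqrt (by linarith) (by nlinarith)] at h2
  refine (hle x).trans ?_
  nlinarith

lemma auxTh_pos {c : ℝ} (hc : 0 < c) (x : EuclideanSpace ℝ (Fin n)) : 0 < auxTh L c x :=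
  (aux_summable L hc x).tsum_pos (fun _ => (Real.exp_pos _).le) 0 (Real.exp_pos _)

lemma aux_cosh_s11 (y : ℝ) : 1 + y ^ 2 / 2 ≤ Real.cosh y := by
  have h1 : Real.cosh y = 1 + 2 * Real.sinh (y / 2) ^ 2 := by
    have := Real.cosh_two_mul (y / 2)
    rw [mul_div_cancel₀ y (two_ne_zero)] at this
    rw [this, Real.cosh_sq]; ring
  have h2 : (y / 2) ^ 2 ≤ Real.sinh (y / 2) ^ 2 := by
    rcases le_total 0 (y / 2) with h | h
    · have := Real.self_le_sinh_iff.mpr h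
      nlinarith
    · have := Real.sinh_le_self_iff.mpr h
      nlinarith
  rw [h1]; nlinarith

lemma aux_summable_sq {c : ℝ} (hc : 0 < c) :
    Summable fun v : L => ‖(v : EuclideanSpace ℝ (Fin n))‖ ^ 2 *
      Real.exp (-c * ‖(v : EuclideanSpace ℝ (Fin n))‖ ^ 2) := by
  refine Summable.of_nonneg_of_le (fun _ => by positivity) (fun v => ?_)
    ((aux_summable0 L (half_pos hc)).mul_left (2 / c))
  set r := ‖(v : EuclideanSpace ℝ (Fin n))‖ ^ 2
  have h1 : r ≤ 2 / c * Real.exp (c / 2 * r) := by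
    have := Real.add_one_le_exp (c / 2 * r)
    calc r = 2 / c * (c / 2 * r) := by field_simp
      _ ≤ _ := by gcongr; linarith
  calc r * Real.exp (-c * r) ≤ 2 / c * Real.exp (c / 2 * r) * Real.exp (-c * r) := by gcongr
    _ = _ := by rw [mul_assoc, ← Real.exp_add]; congr 2; ring

lemma aux_moment_i {c : ℝ} (hc : 0 < c) (i : Fin n) :
    Summable (fun v : L => (v : EuclideanSpace ℝ (Fin n)) i ^ 2 *
      Real.exp (-c * ‖(v : EuclideanSpace ℝ (Fin n))‖ ^ 2)) ∧
    ∑' v : L, (v : EuclideanSpace ℝ (Fin n)) i ^ 2 *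
      Real.exp (-c * ‖(v : EuclideanSpace ℝ (Fin n))‖ ^ 2) ≤ auxTh L c 0 / (2 * c) := by
  have hs : Summable (fun v : L => (v : EuclideanSpace ℝ (Fin n)) i ^ 2 *
      Real.exp (-c * ‖(v : EuclideanSpace ℝ (Fin n))‖ ^ 2)) := by
    refine Summable.of_nonneg_of_le (fun _ => by positivity) (fun v => ?_) (aux_summable_sq L hc)
    gcongr ?_ * _
    rw [← sq_abs]
    gcongr
    exact PiLp.norm_apply_le (v : EuclideanSpace ℝ (Fin n)) i
  refine ⟨hs, ?_⟩
  set s := ∑' v : L, (v : EuclideanSpace ℝ (Fin n)) i ^ 2 *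
      Real.exp (-c * ‖(v : EuclideanSpace ℝ (Fin n))‖ ^ 2) with hsdef
  have hs0 : 0 ≤ s := tsum_nonneg fun _ => by positivity
  have hT := auxTh_pos L hc 0
  have key : ∀ ε : ℝ, auxTh L c 0 + 2 * c ^ 2 * ε ^ 2 * s ≤ Real.exp (c * ε ^ 2) * auxTh L c 0 := by
    intro ε
    let x : EuclideanSpace ℝ (Fin n) := EuclideanSpace.single i ε
    have h1 := auxTh_le L hc x
    have h2 := auxTh_le L hc (-x)
    have h3 : auxTh L c 0 + 2 * c ^ 2 * ε ^ 2 * s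
        ≤ Real.exp (c * ε ^ 2) * ((auxTh L c x + auxTh L c (-x)) / 2) := by
      have hx := aux_summable L hc x
      have hx' := aux_summable L hc (-x)
      have e2 := (((hx.hasSum.add hx'.hasSum).div_const 2).mul_left (Real.exp (c * ε ^ 2)))
      have e1 := (aux_summable L hc 0).hasSum.add (hs.hasSum.mul_left (2 * c ^ 2 * ε ^ 2))
      refine hasSum_le (fun v => ?_) e1 e2
      have n1 : ‖(v : EuclideanSpace ℝ (Fin n)) - x‖ ^ 2
          = ‖(v : EuclideanSpace ℝ (Fin n))‖ ^ 2 - 2 * (ε * (v : EuclideanSpace ℝ (Fin n)) i)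
            + ε ^ 2 := by
        rw [norm_sub_sq_real]; simp [x, EuclideanSpace.inner_single_right]
      have n2 : ‖(v : EuclideanSpace ℝ (Fin n)) - -x‖ ^ 2
          = ‖(v : EuclideanSpace ℝ (Fin n))‖ ^ 2 + 2 * (ε * (v : EuclideanSpace ℝ (Fin n)) i)
            + ε ^ 2 := by
        rw [sub_neg_eq_add, norm_add_sq_real]; simp [x, EuclideanSpace.inner_single_right]
      rw [n1, n2, sub_zero]
      set a := (v : EuclideanSpace ℝ (Fin n)) i
      set N := ‖(v : EuclideanSpace ℝ (Fin n))‖ ^ 2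
      have hch := aux_cosh_s11 (2 * c * ε * a)
      have : Real.exp (c * ε ^ 2) * ((Real.exp (-c * (N - 2 * (ε * a) + ε ^ 2))
          + Real.exp (-c * (N + 2 * (ε * a) + ε ^ 2))) / 2)
          = Real.cosh (2 * c * ε * a) * Real.exp (-c * N) := by
        rw [Real.cosh_eq, mul_div_assoc', div_mul_eq_mul_div]
        congr 1
        rw [mul_add, add_mul, ← Real.exp_add, ← Real.exp_add, ← Real.exp_add, ← Real.exp_add]
        congr 2 <;> ring
      rw [this]
      have := mul_le_mul_of_nonneg_right hch (Real.exp_pos (-c * N)).le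
      nlinarith
    refine h3.trans ?_
    gcongr
    linarith
  -- for small u, 2 c s ≤ T (1 + c u)
  have key2 : ∀ δ : ℝ, 0 < δ → 2 * c * s ≤ auxTh L c 0 + δ := by
    intro δ hδ
    set T := auxTh L c 0
    let z := min 1 (δ / T)
    have hz : 0 < z := lt_min one_pos (by positivity)
    have hz1 : z ≤ 1 := min_le_left _ _
    have hz2 : z * T ≤ δ := by
      have : z ≤ δ / T := min_le_right _ _
      rwa [le_div_iff₀ hT] at this
    have h := key (√(z / c))
    rw [Real.sq_sqrt (by positivity), mul_div_cancel₀ _ hc.ne'] at h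
    have he := Real.abs_exp_sub_one_sub_id_le (x := z) (by rw [abs_of_pos hz]; exact hz1)
    have he' := (abs_le.mp he).2
    have h6 : 2 * c ^ 2 * (z / c) * s = z * (2 * c * s) := by field_simp
    rw [h6] at h
    have h7 : z * (2 * c * s) ≤ z * (T + δ) := by nlinarith
    exact le_of_mul_le_mul_left h7 hz
  have := le_of_forall_pos_le_add key2
  rw [le_div_iff₀ (by positivity)]
  linarith

lemma aux_moment {c : ℝ} (hc : 0 < c) :
    ∑' v : L, ‖(v : EuclideanSpace ℝ (Fin n))‖ ^ 2 *
      Real.exp (-c * ‖(v : EuclideanSpace ℝ (Fin n))‖ ^ 2) ≤ n * auxTh L c 0 / (2 * c) := by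
  have h : ∀ v : L, ‖(v : EuclideanSpace ℝ (Fin n))‖ ^ 2 *
      Real.exp (-c * ‖(v : EuclideanSpace ℝ (Fin n))‖ ^ 2)
      = ∑ i, (v : EuclideanSpace ℝ (Fin n)) i ^ 2 *
      Real.exp (-c * ‖(v : EuclideanSpace ℝ (Fin n))‖ ^ 2) := by
    intro v
    rw [← Finset.sum_mul]
    congr 1
    rw [EuclideanSpace.norm_sq_eq]
    simp
  rw [tsum_congr h, Summable.tsum_finsetSum fun i _ => (aux_moment_i L hc i).1]
  refine (Finset.sum_le_sum fun i _ => (aux_moment_i L hc i).2).trans_eq ?_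
  simp [mul_div_assoc]

lemma aux_step {c h : ℝ} (hc : 0 < c) (hh : 0 ≤ h) :
    Real.exp (-(n / 2 * h)) * auxTh L c 0 ≤ auxTh L (c * (1 + h)) 0 := by
  have hm := aux_moment L hc
  have hs2 := aux_summable_sq L hc
  have hs := aux_summable L hc 0
  have hs' := aux_summable L (c := c * (1 + h)) (by positivity) 0
  set m : ℝ := n / 2 * h
  have hle := hasSum_le (fun v : L => ?_)
    (((hs.hasSum.mul_left (1 + m)).sub (hs2.hasSum.mul_left (c * h))).mul_left (Real.exp (-m)))
    hs'.hasSum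
  · refine le_trans ?_ hle
    change _ ≤ Real.exp (-m) * ((1 + m) * auxTh L c 0 - _)
    gcongr
    have : c * h * ∑' v : L, ‖(v : EuclideanSpace ℝ (Fin n))‖ ^ 2 *
      Real.exp (-c * ‖(v : EuclideanSpace ℝ (Fin n))‖ ^ 2) ≤ m * auxTh L c 0 := by
      refine (mul_le_mul_of_nonneg_left hm (by positivity)).trans_eq ?_
      simp only [m]; field_simp
    linarith
  · simp only [sub_zero]
    set N := ‖(v : EuclideanSpace ℝ (Fin n))‖ ^ 2
    have h1 := Real.add_one_le_exp (m - c * h * N)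
    have h2 : Real.exp (-(c * (1 + h)) * N)
        = Real.exp (-m) * (Real.exp (m - c * h * N) * Real.exp (-c * N)) := by
      rw [← Real.exp_add, ← Real.exp_add]; congr 1; ring
    rw [h2]
    have h3 := mul_le_mul_of_nonneg_right h1 (Real.exp_pos (-c * N)).le
    gcongr
    linarith

lemma aux_iter {c h : ℝ} (hc : 0 < c) (hh : 0 ≤ h) (k : ℕ) :
    Real.exp (-(n / 2 * (k * h))) * auxTh L c 0 ≤ auxTh L (c * (1 + h) ^ k) 0 := by
  induction k with
  | zero => simp
  | succ k ih =>
    have h1 := aux_step L (c := c * (1 + h) ^ k) (h := h) (by positivity) hh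
    rw [pow_succ, ← mul_assoc c]
    refine le_trans ?_ h1
    refine le_trans (le_of_eq ?_) (mul_le_mul_of_nonneg_left ih (Real.exp_pos _).le)
    rw [← mul_assoc (Real.exp _), ← Real.exp_add]
    congr 2; push_cast; ring

lemma aux_scale {c a : ℝ} (hc : 0 < c) (ha : 1 ≤ a) :
    Real.exp (-(n / 2 * Real.log a)) * auxTh L c 0 ≤ auxTh L (c * a) 0 := by
  have ha0 : 0 < a := by linarith
  have ht : Filter.Tendsto (fun k : ℕ => ((k + 1 : ℕ) : ℝ) * (a ^ (((k + 1 : ℕ) : ℝ)⁻¹) - 1))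
      Filter.atTop (nhds (Real.log a)) := by
    have h0 := tendsto_rpow_sub_one_log ha0
    have h1 : Filter.Tendsto (fun k : ℕ => (((k + 1 : ℕ) : ℝ)⁻¹)) Filter.atTop
        (nhdsWithin 0 (Set.Ioi 0)) := by
      refine tendsto_nhdsWithin_iff.mpr ⟨?_, Filter.Eventually.of_forall fun k => ?_⟩
      · exact (tendsto_inv_atTop_nhds_zero_nat (𝕜 := ℝ)).comp (Filter.tendsto_add_atTop_nat 1)
      · simp only [Set.mem_Ioi]; positivity
    refine (h0.comp h1).congr fun k => ?_
    simp
  have ht2 : Filter.Tendsto (fun k : ℕ => Real.exp (-(n / 2 *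
      (((k + 1 : ℕ) : ℝ) * (a ^ (((k + 1 : ℕ) : ℝ)⁻¹) - 1)))) * auxTh L c 0)
      Filter.atTop (nhds (Real.exp (-(n / 2 * Real.log a)) * auxTh L c 0)) :=
    ((Real.continuous_exp.tendsto _).comp (ht.const_mul _).neg).mul_const _
  refine le_of_tendsto' ht2 fun k => ?_
  have := aux_iter L hc (h := a ^ (((k + 1 : ℕ) : ℝ)⁻¹) - 1)
    (sub_nonneg.mpr (Real.one_le_rpow ha (by positivity))) (k + 1)
  refine this.trans_eq ?_
  rw [add_sub_cancel, Real.rpow_inv_natCast_pow ha0.le (by omega)]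

end



/-- For any euclidean lattice `E` of positive rank `n`,
`h⁰_θ(E) − (n/2) log n + log(1 − 1/(2π)) ≤ log |{v ∈ E : ‖v‖ ≤ 1}| ≤ h⁰_θ(E) + π`. -/
theorem h0theta_compare_card_unit_ball {n : ℕ} (hn : 0 < n)
    (L : Submodule ℤ (EuclideanSpace ℝ (Fin n)))
    [DiscreteTopology L] [IsZLattice ℝ L] :
    Real.log (∑' v : L, Real.exp (-π * ‖(v : EuclideanSpace ℝ (Fin n))‖ ^ 2)) -
          ((n : ℝ) / 2) * Real.log n + Real.log (1 - 1 / (2 * π)) ≤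
        Real.log (Nat.card {v : L // ‖(v : EuclideanSpace ℝ (Fin n))‖ ≤ 1} : ℝ) ∧
      Real.log (Nat.card {v : L // ‖(v : EuclideanSpace ℝ (Fin n))‖ ≤ 1} : ℝ) ≤
        Real.log (∑' v : L, Real.exp (-π * ‖(v : EuclideanSpace ℝ (Fin n))‖ ^ 2)) + π := by
  classical
  have hpi := Real.pi_pos
  have hpi3 := Real.pi_gt_three
  have hn0 : (0 : ℝ) < n := by exact_mod_cast hn
  have hn1 : (1 : ℝ) ≤ n := by exact_mod_cast hn
  have hθ : (∑' v : L, Real.exp (-π * ‖(v : EuclideanSpace ℝ (Fin n))‖ ^ 2)) = auxTh L π 0 := by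
    simp [auxTh]
  rw [hθ]
  have hT := auxTh_pos L hpi 0
  have hfin : {v : L | ‖(v : EuclideanSpace ℝ (Fin n))‖ ≤ 1}.Finite := by
    have h1 := (aux_summable0 L hpi).tendsto_cofinite_zero.eventually_lt_const
      (Real.exp_pos (-π))
    rw [Filter.eventually_cofinite] at h1
    refine h1.subset fun v hv => ?_
    simp only [Set.mem_ofPred_eq, not_lt, Real.exp_le_exp] at hv ⊢
    have : ‖(v : EuclideanSpace ℝ (Fin n))‖ ^ 2 ≤ 1 := pow_le_one₀ (norm_nonneg _) hv
    nlinarith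
  let S := hfin.toFinset
  have hS : ∀ v, v ∈ S ↔ ‖(v : EuclideanSpace ℝ (Fin n))‖ ≤ 1 := fun v => by simp [S]
  have hcard : (Nat.card {v : L // ‖(v : EuclideanSpace ℝ (Fin n))‖ ≤ 1}) = S.card :=
    Nat.card_eq_card_finite_toFinset hfin
  rw [hcard]
  have hSpos : (0 : ℝ) < S.card := by
    have : (0 : L) ∈ S := by simp [hS]
    exact_mod_cast Finset.card_pos.mpr ⟨0, this⟩
  constructor
  · have hc : 0 < π * n := by positivity
    have h1 := aux_scale L hpi hn1
    have h2 := aux_moment L hc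
    have h3 : (n : ℝ) * auxTh L (π * n) 0 / (2 * (π * n)) = 1 / (2 * π) * auxTh L (π * n) 0 := by
      field_simp
    rw [h3] at h2
    have hle : auxTh L (π * n) 0 ≤ S.card + 1 / (2 * π) * auxTh L (π * n) 0 := by
      have e1 : HasSum (fun v : L => if v ∈ S then (1 : ℝ) else 0) S.card := by
        have := hasSum_sum_of_ne_finset_zero (L := SummationFilter.unconditional L) (f := fun v : L => if v ∈ S then (1 : ℝ) else 0)
          (s := S) (fun v hv => by simp [hv])
        simpa using this
      have e2 := e1.add (aux_summable_sq L hc).hasSum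
      refine (hasSum_le (fun v => ?_) (aux_summable L hc 0).hasSum e2).trans
        (by gcongr)
      rw [sub_zero]
      by_cases hv : v ∈ S
      · simp only [hv, if_true]
        have : Real.exp (-(π * n) * ‖(v : EuclideanSpace ℝ (Fin n))‖ ^ 2) ≤ 1 := by
          rw [Real.exp_le_one_iff]
          have : 0 ≤ (π * n) * ‖(v : EuclideanSpace ℝ (Fin n))‖ ^ 2 := by positivity
          linarith
        have : 0 ≤ ‖(v : EuclideanSpace ℝ (Fin n))‖ ^ 2 *
          Real.exp (-(π * n) * ‖(v : EuclideanSpace ℝ (Fin n))‖ ^ 2) := by positivity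
        linarith
      · simp only [hv, if_false, zero_add]
        rw [hS, not_le] at hv
        exact le_mul_of_one_le_left (Real.exp_pos _).le (one_le_pow₀ hv.le)
    have hq : 0 < 1 - 1 / (2 * π) := by
      rw [sub_pos, div_lt_one (by positivity)]; linarith
    have hfinal : (1 - 1 / (2 * π)) * (Real.exp (-(n / 2 * Real.log n)) * auxTh L π 0)
        ≤ S.card := by
      refine (mul_le_mul_of_nonneg_left h1 hq.le).trans ?_
      linarith
    have := Real.log_le_log (by positivity) hfinal
    rw [Real.log_mul hq.ne' (by positivity), Real.log_mul (by positivity) hT.ne',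
      Real.log_exp] at this
    linarith
  · have h1 : (S.card : ℝ) * Real.exp (-π) ≤ auxTh L π 0 := by
      rw [← hθ]
      refine le_trans ?_ ((aux_summable0 L hpi).sum_le_tsum S fun _ _ => (Real.exp_pos _).le)
      rw [← nsmul_eq_mul]
      refine Finset.card_nsmul_le_sum _ _ _ fun v hv => ?_
      rw [hS] at hv
      rw [Real.exp_le_exp]
      have : ‖(v : EuclideanSpace ℝ (Fin n))‖ ^ 2 ≤ 1 := pow_le_one₀ (norm_nonneg _) hv
      nlinarith
    have := Real.log_le_log (by positivity) h1
    rw [Real.log_mul hSpos.ne' (by positivity), Real.log_exp] at this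
    linarith
end

section
/- Let E_• : E_0 ← E_1 ← E_2 ← ... be a projective system of admissible surjections of euclidean lattices (each quotient map q_i : E_{i+1} → E_i surjective, with the norm on E_i ⊗ R the quotient norm), and suppose Σ_{i≥0} h⁰_θ(ker q_i) < ∞, where ker q_i carries the norm restricted from E_{i+1}. Then the limit lim_{i→∞} h⁰_θ(E_i) exists in [0, ∞), and for every k, lim_{i→∞} h⁰_θ(E_i) ≤ h⁰_θ(E_k) + Σ_{j≥k} h⁰_θ(ker q_j). -/
open scoped Real

/-- `h⁰_θ` of a lattice in a euclidean space. -/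
noncomputable def h0theta {n : ℕ} (L : Submodule ℤ (EuclideanSpace ℝ (Fin n))) : ℝ :=
  Real.log (∑' v : L, Real.exp (-π * ‖(v : EuclideanSpace ℝ (Fin n))‖ ^ 2))

/-- `h⁰_θ` of the kernel of a surjection `q`, with the norm restricted from the ambient
lattice. -/
noncomputable def h0thetaKer {m k : ℕ} (L : Submodule ℤ (EuclideanSpace ℝ (Fin m)))
    (q : EuclideanSpace ℝ (Fin m) →ₗ[ℝ] EuclideanSpace ℝ (Fin k)) : ℝ :=
  Real.log (∑' w : {w : L // q (w : EuclideanSpace ℝ (Fin m)) = 0},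
    Real.exp (-π * ‖((w : L) : EuclideanSpace ℝ (Fin m))‖ ^ 2))

open scoped ENNReal in
/-- Gaussian sum over a translate of a subgroup, valued in `ℝ≥0∞`. -/
noncomputable def Th {E : Type*} [NormedAddCommGroup E] (a : ℝ) (K : AddSubgroup E) (x : E) : ℝ≥0∞ :=
  ∑' k : K, ENNReal.ofReal (Real.exp (-a * ‖x + (k : E)‖ ^ 2))

lemma ennreal_two_mul_le (x y : ENNReal) : 2 * (x * y) ≤ x ^ 2 + y ^ 2 := by
  rcases eq_or_ne x ⊤ with rfl | hx
  · simp
  rcases eq_or_ne y ⊤ with rfl | hy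
  · simp
  lift x to NNReal using hx
  lift y to NNReal using hy
  norm_cast
  rw [← NNReal.coe_le_coe]
  push_cast
  nlinarith [sq_nonneg ((x : ℝ) - y)]

lemma ennreal_cs {ι : Type*} (A B : ι → ENNReal) :
    (∑' c, A c * B c) ^ 2 ≤ (∑' c, A c ^ 2) * (∑' c, B c ^ 2) := by
  have h2 : 2 * (∑' c, A c * B c) ^ 2 ≤ 2 * ((∑' c, A c ^ 2) * (∑' c, B c ^ 2)) := by
    calc 2 * (∑' c, A c * B c) ^ 2
        = ∑' c, ∑' d, 2 * ((A c * B d) * (A d * B c)) := by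
          rw [sq, ← ENNReal.tsum_mul_right, ← ENNReal.tsum_mul_left]
          refine tsum_congr fun c => ?_
          rw [← ENNReal.tsum_mul_left, ← ENNReal.tsum_mul_left]
          refine tsum_congr fun d => ?_
          ring
      _ ≤ ∑' c, ∑' d, ((A c * B d) ^ 2 + (A d * B c) ^ 2) :=
          ENNReal.tsum_le_tsum fun c => ENNReal.tsum_le_tsum fun d => ennreal_two_mul_le _ _
      _ = ∑' c, ∑' d, (A c) ^ 2 * (B d) ^ 2 + ∑' c, ∑' d, (A d) ^ 2 * (B c) ^ 2 := by
          rw [← ENNReal.tsum_add]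
          refine tsum_congr fun c => ?_
          rw [← ENNReal.tsum_add]
          refine tsum_congr fun d => ?_
          rw [mul_pow, mul_pow]
      _ = 2 * ((∑' c, A c ^ 2) * (∑' c, B c ^ 2)) := by
          rw [two_mul]
          congr 1
          · rw [← ENNReal.tsum_mul_right]
            exact tsum_congr fun c => ENNReal.tsum_mul_left
          · rw [← ENNReal.tsum_mul_left]
            exact tsum_congr fun c => ENNReal.tsum_mul_right
  exact (ENNReal.mul_le_mul_iff_right (by norm_num) (by norm_num)).1 h2

section
variable {E : Type*} [NormedAddCommGroup E] [InnerProductSpace ℝ E]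

lemma bij_two (K : AddSubgroup E) :
    Function.Bijective (fun p : (K ⧸ (nsmulAddMonoidHom 2 : K →+ K).range) × K × K =>
      ((p.1.out + p.2.1 + p.2.2, p.2.1 - p.2.2) : K × K)) := by
  have tf : ∀ x : K, (2 : ℕ) • x = 0 → x = 0 := by
    intro x hx
    have : (2 : ℕ) • (x : E) = 0 := by exact_mod_cast congrArg Subtype.val hx
    have h2 : (2 : ℝ) • (x : E) = 0 := by rw [← this, two_smul, two_nsmul]
    exact Subtype.ext ((smul_eq_zero.1 h2).resolve_left (by norm_num))
  constructor
  · rintro ⟨c, m, n⟩ ⟨c', m', n'⟩ h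
    simp only [Prod.mk.injEq] at h
    obtain ⟨h1, h2⟩ := h
    have hc : c = c' := by
      rw [← QuotientAddGroup.out_eq' c, ← QuotientAddGroup.out_eq' c', QuotientAddGroup.eq]
      refine ⟨m - m', ?_⟩
      simp only [nsmulAddMonoidHom_apply, two_nsmul]
      have := congrArg₂ (· + ·) h1 h2
      have e : c'.out = c.out + m + n + (m - n) - m' - n' - (m' - n') + n' + n' - n' - n' := by
        rw [this]; abel
      rw [e]; abel
    subst hc
    have hm : m = m' := by
      rw [← sub_eq_zero]
      apply tf
      have := congrArg₂ (· + ·) h1 h2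
      have e : 2 • (m - m') = (c.out + m + n + (m - n)) - (c.out + m' + n' + (m' - n')) := by
        abel
      rw [e, this, sub_self]
    subst hm
    simpa using h2
  · rintro ⟨k, k'⟩
    have : ((QuotientAddGroup.mk (k + k') : K ⧸ (nsmulAddMonoidHom 2 : K →+ K).range).out :
      K ⧸ (nsmulAddMonoidHom 2 : K →+ K).range) = QuotientAddGroup.mk (k + k') :=
      QuotientAddGroup.out_eq' _
    rw [QuotientAddGroup.eq] at this
    obtain ⟨m, hm⟩ := this
    simp only [nsmulAddMonoidHom_apply, two_nsmul] at hm
    refine ⟨(QuotientAddGroup.mk (k + k'), m, m - k'), ?_⟩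
    simp only [Prod.mk.injEq]
    constructor
    · rw [show ∀ z : K, z + m + (m - k') = z + (m + m) - k' by intro z; abel, hm]
      abel
    · abel

lemma Th_mul (a : ℝ) (K : AddSubgroup E) (x y : E) :
    Th a K x * Th a K y = ∑' c : K ⧸ (nsmulAddMonoidHom 2 : K →+ K).range,
      Th (2 * a) K ((1 / 2 : ℝ) • (x + y + (c.out : K))) *
        Th (2 * a) K ((1 / 2 : ℝ) • (x - y + (c.out : K))) := by
  have h1 : ∀ (b b' : ℝ) (u v : E), Th b K u * Th b' K v = ∑' p : K × K,
      ENNReal.ofReal (Real.exp (-b * ‖u + (p.1 : E)‖ ^ 2)) *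
        ENNReal.ofReal (Real.exp (-b' * ‖v + (p.2 : E)‖ ^ 2)) := by
    intro b b' u v
    rw [ENNReal.tsum_prod', Th, Th, ← ENNReal.tsum_mul_right]
    exact tsum_congr fun c => ENNReal.tsum_mul_left.symm
  simp_rw [h1]
  rw [← (Equiv.ofBijective _ (bij_two K)).tsum_eq, ENNReal.tsum_prod']
  refine tsum_congr fun c => tsum_congr fun p => ?_
  rw [← ENNReal.ofReal_mul (Real.exp_nonneg _), ← ENNReal.ofReal_mul (Real.exp_nonneg _),
    ← Real.exp_add, ← Real.exp_add]
  congr 2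
  obtain ⟨m, n⟩ := p
  simp only [Equiv.ofBijective_apply, AddSubgroup.coe_add, AddSubgroup.coe_sub]
  generalize ((c.out : K) : E) = c
  generalize (m : E) = m
  generalize (n : E) = n
  have := parallelogram_law_with_norm ℝ ((1 / 2 : ℝ) • (x + y + c) + m) ((1 / 2 : ℝ) • (x - y + c) + n)
  have e1 : (1 / 2 : ℝ) • (x + y + c) + m + ((1 / 2 : ℝ) • (x - y + c) + n) = x + (c + m + n) := by
    module
  have e2 : (1 / 2 : ℝ) • (x + y + c) + m - ((1 / 2 : ℝ) • (x - y + c) + n) = y + (m - n) := by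
    module
  rw [e1, e2] at this
  linear_combination (-a) * this

lemma Th_pow_four (a : ℝ) (K : AddSubgroup E) (t : E) :
    Th a K t ^ 4 ≤ Th a K ((2 : ℝ) • t) * Th a K 0 ^ 3 := by
  have h1 := Th_mul a K t t
  have h2 := Th_mul a K ((2 : ℝ) • t) 0
  have h3 := Th_mul a K 0 0
  simp only [← two_smul ℝ t, sub_self, add_zero, sub_zero] at h1 h2 h3
  have := ennreal_cs (fun c : K ⧸ (nsmulAddMonoidHom 2 : K →+ K).range =>
    Th (2 * a) K ((1 / 2 : ℝ) • ((2 : ℝ) • t + (c.out : K))))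
    (fun c => Th (2 * a) K ((1 / 2 : ℝ) • (0 + (c.out : K))))
  simp only [sq, ← h1, ← h2, ← h3] at this
  calc _ = Th a K t * Th a K t * (Th a K t * Th a K t) := by ring
    _ ≤ _ := this
    _ = _ := by ring

lemma Th_growth (a ε : ℝ) (ha : 0 ≤ a) (hε : 0 < ε) (K : AddSubgroup E) (t : E) :
    Th a K t ≤ ENNReal.ofReal (Real.exp (a * ε * ‖t‖ ^ 2)) * Th (a * (ε / (1 + ε))) K 0 := by
  rw [Th, Th, ← ENNReal.tsum_mul_left]
  refine ENNReal.tsum_le_tsum fun k => ?_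
  rw [← ENNReal.ofReal_mul (Real.exp_nonneg _), ← Real.exp_add]
  refine ENNReal.ofReal_le_ofReal (Real.exp_le_exp.2 ?_)
  rw [zero_add]
  have h1 : ‖(k : E)‖ ≤ ‖t + k‖ + ‖t‖ := by
    have := norm_sub_le (t + (k : E)) t
    rwa [add_sub_cancel_left] at this
  have h2 : ε / (1 + ε) * ‖(k : E)‖ ^ 2 ≤ ‖t + k‖ ^ 2 + ε * ‖t‖ ^ 2 := by
    have h3 : ‖(k : E)‖ ^ 2 ≤ (‖t + k‖ + ‖t‖) ^ 2 := by gcongr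
    rw [div_mul_eq_mul_div, div_le_iff₀ (by positivity)]
    nlinarith [sq_nonneg (‖t + k‖ - ε * ‖t‖), mul_le_mul_of_nonneg_left h3 hε.le]
  nlinarith [mul_le_mul_of_nonneg_left h2 ha]

lemma Th_le (a : ℝ) (ha : 0 < a) (K : AddSubgroup E) (hK : ∀ δ > 0, Th δ K 0 ≠ ⊤) (t : E) :
    Th a K t ≤ Th a K 0 := by
  have hfin : ∀ t, Th a K t ≠ ⊤ := by
    intro t
    refine ne_top_of_le_ne_top ?_ (Th_growth a 1 ha.le one_pos K t)
    exact ENNReal.mul_ne_top ENNReal.ofReal_ne_top (hK _ (by positivity))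
  have hpos : ∀ b x, 0 < Th b K x := by
    intro b x
    refine lt_of_lt_of_le ?_ (ENNReal.le_tsum (0 : K))
    exact ENNReal.ofReal_pos.2 (Real.exp_pos _)
  have hpos' : ∀ x, 0 < (Th a K x).toReal := fun x => ENNReal.toReal_pos (hpos _ _).ne' (hfin x)
  set f : E → ℝ := fun x => Real.log (Th a K x).toReal - Real.log (Th a K 0).toReal with hf
  have hf4 : ∀ x, 4 * f x ≤ f ((2 : ℝ) • x) := by
    intro x
    have h := ENNReal.toReal_mono (ENNReal.mul_ne_top (hfin _) (ENNReal.pow_ne_top (hfin _)))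
      (Th_pow_four a K x)
    rw [ENNReal.toReal_mul, ENNReal.toReal_pow, ENNReal.toReal_pow] at h
    have h' := Real.log_le_log (pow_pos (hpos' x) 4) h
    rw [Real.log_mul (hpos' _).ne' (pow_pos (hpos' _) _).ne', Real.log_pow, Real.log_pow] at h'
    push_cast at h'
    simp only [hf]
    linarith
  have hfn : ∀ n : ℕ, ∀ x, (4 : ℝ) ^ n * f x ≤ f ((2 : ℝ) ^ n • x) := by
    intro n
    induction n with
    | zero => intro x; simp
    | succ n ih =>
      intro x
      have h1 := ih ((2 : ℝ) • x)
      rw [smul_smul, ← pow_succ] at h1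
      have h2 := mul_le_mul_of_nonneg_left (hf4 x) (by positivity : (0 : ℝ) ≤ 4 ^ n)
      rw [pow_succ]
      linarith
  have hle : ∀ ε > 0, f t ≤ a * ε * ‖t‖ ^ 2 := by
    intro ε hε
    set C := Real.log (Th (a * (ε / (1 + ε))) K 0).toReal - Real.log (Th a K 0).toReal with hC
    have hg : ∀ x, f x ≤ a * ε * ‖x‖ ^ 2 + C := by
      intro x
      have hk := hK (a * (ε / (1 + ε))) (by positivity)
      have h := ENNReal.toReal_mono (ENNReal.mul_ne_top ENNReal.ofReal_ne_top hk)
        (Th_growth a ε ha.le hε K x)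
      rw [ENNReal.toReal_mul, ENNReal.toReal_ofReal (Real.exp_nonneg _)] at h
      have h' := Real.log_le_log (hpos' x) h
      rw [Real.log_mul (Real.exp_pos _).ne' (ENNReal.toReal_pos (hpos _ _).ne' hk).ne',
        Real.log_exp] at h'
      simp only [hf, hC]
      linarith
    by_contra! hcon
    have hbig : Filter.Tendsto (fun n : ℕ => (4 : ℝ) ^ n * (f t - a * ε * ‖t‖ ^ 2))
        Filter.atTop Filter.atTop :=
      (tendsto_pow_atTop_atTop_of_one_lt (by norm_num)).atTop_mul_const (by linarith)
    obtain ⟨n, hn⟩ := (hbig.eventually_gt_atTop C).exists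
    have h1 := (hfn n t).trans (hg _)
    rw [norm_smul, mul_pow, norm_pow, Real.norm_ofNat, ← pow_mul, mul_comm n 2, pow_mul] at h1
    norm_num at h1
    nlinarith
  have h0 : f t ≤ 0 := by
    by_contra! hcon
    have := hle (f t / (2 * a * (‖t‖ ^ 2 + 1))) (by positivity)
    have e : a * (f t / (2 * a * (‖t‖ ^ 2 + 1))) * ‖t‖ ^ 2 = f t / 2 * (‖t‖ ^ 2 / (‖t‖ ^ 2 + 1)) := by
      field_simp
    rw [e] at this
    have h1 : ‖t‖ ^ 2 / (‖t‖ ^ 2 + 1) ≤ 1 := by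
      rw [div_le_one (by positivity)]; linarith
    nlinarith
  rw [← ENNReal.toReal_le_toReal (hfin _) (hfin _), ← Real.log_le_log_iff (hpos' _) (hpos' _)]
  simp only [hf] at h0
  linarith

end

lemma summable_gauss {n : ℕ} (L : Submodule ℤ (EuclideanSpace ℝ (Fin n)))
    (hL : DiscreteTopology L) (δ : ℝ) (hδ : 0 < δ) :
    Summable fun v : L => Real.exp (-δ * ‖(v : EuclideanSpace ℝ (Fin n))‖ ^ 2) := by
  set N := Module.finrank ℤ L + 1 with hN
  have h := (ZLattice.summable_norm_pow_inv L (2 * N) (by omega)).mul_left (N.factorial / δ ^ N : ℝ)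
  refine Summable.of_norm_bounded_eventually h ?_
  rw [Filter.eventually_cofinite]
  refine (Set.finite_singleton (0 : L)).subset fun v hv => ?_
  simp only [Set.mem_ofPred_eq] at hv
  by_contra hv0
  apply hv
  have hp : 0 < ‖v‖ := norm_pos_iff.2 hv0
  rw [Real.norm_of_nonneg (Real.exp_nonneg _), neg_mul, Real.exp_neg]
  have h1 := Real.pow_div_factorial_le_exp (δ * ‖v‖ ^ 2) (by positivity) N
  calc (Real.exp (δ * ‖v‖ ^ 2))⁻¹ ≤ ((δ * ‖v‖ ^ 2) ^ N / N.factorial)⁻¹ := by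
        gcongr
    _ = _ := by
        rw [mul_pow, ← pow_mul, inv_div, inv_pow]
        field_simp

lemma ker_inj {m k : ℕ} (L : Submodule ℤ (EuclideanSpace ℝ (Fin m)))
    (q : EuclideanSpace ℝ (Fin m) →ₗ[ℝ] EuclideanSpace ℝ (Fin k)) (hL : DiscreteTopology L)
    (δ : ℝ) (hδ : 0 < δ) :
    Summable fun w : {w : L // q (w : EuclideanSpace ℝ (Fin m)) = 0} =>
      Real.exp (-δ * ‖((w : L) : EuclideanSpace ℝ (Fin m))‖ ^ 2) :=
  (summable_gauss L hL δ hδ).comp_injective Subtype.val_injective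

lemma h0theta_nonneg {m : ℕ} (L : Submodule ℤ (EuclideanSpace ℝ (Fin m)))
    (hL : DiscreteTopology L) : 0 ≤ h0theta L := by
  refine Real.log_nonneg ?_
  refine le_trans ?_ ((summable_gauss L hL π Real.pi_pos).le_tsum 0 fun _ _ => Real.exp_nonneg _)
  simp

lemma h0thetaKer_nonneg {m k : ℕ} (L : Submodule ℤ (EuclideanSpace ℝ (Fin m)))
    (q : EuclideanSpace ℝ (Fin m) →ₗ[ℝ] EuclideanSpace ℝ (Fin k))
    (hL : DiscreteTopology L) : 0 ≤ h0thetaKer L q := by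
  refine Real.log_nonneg ?_
  refine le_trans ?_ ((ker_inj L q hL π Real.pi_pos).le_tsum ⟨0, by simp⟩
    fun _ _ => Real.exp_nonneg _)
  simp

/-- Kernel lattice as a subgroup. -/
def kerSub {m k : ℕ} (L : Submodule ℤ (EuclideanSpace ℝ (Fin m)))
    (q : EuclideanSpace ℝ (Fin m) →ₗ[ℝ] EuclideanSpace ℝ (Fin k)) :
    AddSubgroup (EuclideanSpace ℝ (Fin m)) :=
  L.toAddSubgroup ⊓ (LinearMap.ker q).toAddSubgroup

/-- The two descriptions of the kernel lattice. -/
def kerEquiv {m k : ℕ} (L : Submodule ℤ (EuclideanSpace ℝ (Fin m)))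
    (q : EuclideanSpace ℝ (Fin m) →ₗ[ℝ] EuclideanSpace ℝ (Fin k)) :
    {w : L // q (w : EuclideanSpace ℝ (Fin m)) = 0} ≃ kerSub L q where
  toFun w := ⟨w.1.1, w.1.2, w.2⟩
  invFun w := ⟨⟨w.1, w.2.1⟩, w.2.2⟩
  left_inv _ := rfl
  right_inv _ := rfl

lemma Th_ker {m k : ℕ} (L : Submodule ℤ (EuclideanSpace ℝ (Fin m)))
    (q : EuclideanSpace ℝ (Fin m) →ₗ[ℝ] EuclideanSpace ℝ (Fin k)) (hL : DiscreteTopology L)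
    (δ : ℝ) (hδ : 0 < δ) :
    Th δ (kerSub L q) 0 = ENNReal.ofReal
      (∑' w : {w : L // q (w : EuclideanSpace ℝ (Fin m)) = 0},
        Real.exp (-δ * ‖((w : L) : EuclideanSpace ℝ (Fin m))‖ ^ 2)) := by
  rw [ENNReal.ofReal_tsum_of_nonneg (fun _ => Real.exp_nonneg _) (ker_inj L q hL δ hδ), Th,
    ← (kerEquiv L q).tsum_eq]
  refine tsum_congr fun w => ?_
  rw [zero_add]
  rfl

lemma subadd {m k : ℕ} (L' : Submodule ℤ (EuclideanSpace ℝ (Fin m)))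
    (L : Submodule ℤ (EuclideanSpace ℝ (Fin k)))
    (q : EuclideanSpace ℝ (Fin m) →ₗ[ℝ] EuclideanSpace ℝ (Fin k))
    (hL' : DiscreteTopology L') (hL : DiscreteTopology L)
    (hmap : ∀ w ∈ L', q w ∈ L)
    (hsurj : ∀ v ∈ L, ∃ w ∈ L', q w = v)
    (hcontr : ∀ w, ‖q w‖ ≤ ‖w‖)
    (hlift : ∀ v, ∃ w, q w = v ∧ ‖w‖ = ‖v‖) :
    h0theta L' ≤ h0theta L + h0thetaKer L' q := by
  choose σ hσL hσ using fun v : L => hsurj v v.2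
  choose s hs hsn using hlift
  have horth : ∀ v t, q t = 0 → inner ℝ (s v) t = 0 := by
    intro v t ht
    have h : ∀ x : ℝ, 0 ≤ ‖t‖ ^ 2 * (x * x) + (2 * inner ℝ (s v) t) * x + 0 := by
      intro x
      have h1 := hcontr (s v + x • t)
      rw [map_add, map_smul, ht, smul_zero, add_zero, hs, ← hsn v] at h1
      have h2 : ‖s v‖ ^ 2 ≤ ‖s v + x • t‖ ^ 2 := by gcongr
      rw [norm_add_sq_real, inner_smul_right, norm_smul, mul_pow, Real.norm_eq_abs, sq_abs] at h2
      nlinarith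
    have := discrim_le_zero h
    rw [discrim] at this
    nlinarith [sq_nonneg (inner ℝ (s v) t)]
  have hbij : Function.Bijective (fun p : L × kerSub L' q =>
      (⟨σ p.1 + p.2, L'.add_mem (hσL p.1) p.2.2.1⟩ : L')) := by
    constructor
    · rintro ⟨v, x⟩ ⟨v', x'⟩ h
      have h1 : σ v + (x : EuclideanSpace ℝ (Fin m)) = σ v' + x' := congrArg Subtype.val h
      have hx : q x = 0 := x.2.2
      have hx' : q x' = 0 := x'.2.2
      have h2 := congrArg q h1
      rw [map_add, map_add, hx, hx', hσ, hσ, add_zero, add_zero] at h2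
      have hv : v = v' := Subtype.ext h2
      subst hv
      have : x = x' := Subtype.ext (add_left_cancel h1)
      rw [this]
    · intro w
      refine ⟨(⟨q w, hmap w w.2⟩, ⟨w - σ ⟨q w, hmap w w.2⟩, L'.sub_mem w.2 (hσL _), ?_⟩), ?_⟩
      · change q _ = 0
        rw [map_sub, hσ, sub_self]
      · apply Subtype.ext
        simp
  have hK : ∀ δ > 0, Th δ (kerSub L' q) 0 ≠ ⊤ := by
    intro δ hδ
    rw [Th_ker L' q hL' δ hδ]
    exact ENNReal.ofReal_ne_top
  have key : ENNReal.ofReal (∑' v : L', Real.exp (-π * ‖(v : EuclideanSpace ℝ (Fin m))‖ ^ 2)) ≤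
      ENNReal.ofReal (∑' v : L, Real.exp (-π * ‖(v : EuclideanSpace ℝ (Fin k))‖ ^ 2)) *
        ENNReal.ofReal (∑' w : {w : L' // q (w : EuclideanSpace ℝ (Fin m)) = 0},
          Real.exp (-π * ‖((w : L') : EuclideanSpace ℝ (Fin m))‖ ^ 2)) := by
    rw [← Th_ker L' q hL' π Real.pi_pos,
      ENNReal.ofReal_tsum_of_nonneg (fun _ => Real.exp_nonneg _) (summable_gauss L' hL' π Real.pi_pos),
      ENNReal.ofReal_tsum_of_nonneg (fun _ => Real.exp_nonneg _) (summable_gauss L hL π Real.pi_pos),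
      ← (Equiv.ofBijective _ hbij).tsum_eq, ENNReal.tsum_prod', ← ENNReal.tsum_mul_right]
    refine ENNReal.tsum_le_tsum fun v => ?_
    refine le_trans (le_of_eq ?_)
      (mul_le_mul_right (Th_le π Real.pi_pos (kerSub L' q) hK (σ v - s v)) _)
    rw [Th, ← ENNReal.tsum_mul_left]
    refine tsum_congr fun x => ?_
    rw [← ENNReal.ofReal_mul (Real.exp_nonneg _), ← Real.exp_add]
    congr 2
    have hx : q x = 0 := x.2.2
    have h0 := horth v (σ v - s v + x) (by rw [map_add, map_sub, hσ, hs, hx]; simp)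
    have e : σ v + (x : EuclideanSpace ℝ (Fin m)) = s v + (σ v - s v + x) := by abel
    simp only [Equiv.ofBijective_apply]
    rw [e, norm_add_sq_real, h0, hsn]
    ring
  have p1 : 0 < ∑' v : L', Real.exp (-π * ‖(v : EuclideanSpace ℝ (Fin m))‖ ^ 2) :=
    (summable_gauss L' hL' π Real.pi_pos).tsum_pos (fun _ => Real.exp_nonneg _) 0 (Real.exp_pos _)
  have p2 : 0 < ∑' v : L, Real.exp (-π * ‖(v : EuclideanSpace ℝ (Fin k))‖ ^ 2) :=
    (summable_gauss L hL π Real.pi_pos).tsum_pos (fun _ => Real.exp_nonneg _) 0 (Real.exp_pos _)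
  have p3 : 0 < ∑' w : {w : L' // q (w : EuclideanSpace ℝ (Fin m)) = 0},
          Real.exp (-π * ‖((w : L') : EuclideanSpace ℝ (Fin m))‖ ^ 2) :=
    (ker_inj L' q hL' π Real.pi_pos).tsum_pos (fun _ => Real.exp_nonneg _) ⟨0, by simp⟩
      (Real.exp_pos _)
  rw [← ENNReal.ofReal_mul p2.le, ENNReal.ofReal_le_ofReal_iff (by positivity)] at key
  have := Real.log_le_log p1 key
  rwa [Real.log_mul p2.ne' p3.ne'] at this

lemma limit_real (a k : ℕ → ℝ) (ha : ∀ i, 0 ≤ a i) (hk : ∀ i, 0 ≤ k i)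
    (h : ∀ i, a (i + 1) ≤ a i + k i) (hsum : Summable k) :
    ∃ l : ℝ, 0 ≤ l ∧ Filter.Tendsto a Filter.atTop (nhds l) ∧
      ∀ i, l ≤ a i + ∑' j : ℕ, k (i + j) := by
  have hanti : Antitone fun i => a i - ∑ j ∈ Finset.range i, k j := by
    refine antitone_nat_of_succ_le fun i => ?_
    rw [Finset.sum_range_succ]
    linarith [h i]
  have hb : BddBelow (Set.range fun i => a i - ∑ j ∈ Finset.range i, k j) := by
    refine ⟨-∑' j, k j, ?_⟩
    rintro _ ⟨i, rfl⟩
    have := hsum.sum_le_tsum (Finset.range i) fun j _ => hk j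
    simp only
    linarith [ha i]
  have ht := (tendsto_atTop_ciInf hanti hb).add hsum.hasSum.tendsto_sum_nat
  simp only [sub_add_cancel] at ht
  refine ⟨_, ge_of_tendsto' ht ha, ht, fun i => ?_⟩
  have h1 := ciInf_le hb i
  have h2 := hsum.sum_add_tsum_nat_add i
  simp only [add_comm _ i] at h2
  linarith

/-- Let `E_• : E_0 ← E_1 ← E_2 ← ...` be a projective system of admissible
surjections of euclidean lattices (each `q_i : E_{i+1} → E_i` surjective on lattice points, and
the norm on `E_i ⊗ ℝ` the quotient norm: `q_i` is norm-nonincreasing and every vector admits a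
norm-preserving lift), and suppose `Σ_{i≥0} h⁰_θ(ker q_i) < ∞`, where `ker q_i` carries the norm
restricted from `E_{i+1}`. Then `lim_{i→∞} h⁰_θ(E_i)` exists in `[0, ∞)`, and for every `k`,
`lim_{i→∞} h⁰_θ(E_i) ≤ h⁰_θ(E_k) + Σ_{j≥k} h⁰_θ(ker q_j)`. -/
theorem h0theta_limit_of_summable_projective_system (n : ℕ → ℕ)
    (L : ∀ i, Submodule ℤ (EuclideanSpace ℝ (Fin (n i))))
    (hdisc : ∀ i, DiscreteTopology (L i))
    (hspan : ∀ i, Submodule.span ℝ ((L i : Set (EuclideanSpace ℝ (Fin (n i))))) = ⊤)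
    (q : ∀ i, EuclideanSpace ℝ (Fin (n (i + 1))) →ₗ[ℝ] EuclideanSpace ℝ (Fin (n i)))
    (hmap : ∀ i, ∀ w ∈ L (i + 1), q i w ∈ L i)
    (hsurj : ∀ i, ∀ v ∈ L i, ∃ w ∈ L (i + 1), q i w = v)
    (hcontr : ∀ i w, ‖q i w‖ ≤ ‖w‖)
    (hlift : ∀ i v, ∃ w, q i w = v ∧ ‖w‖ = ‖v‖)
    (hsum : Summable fun i => h0thetaKer (L (i + 1)) (q i)) :
    ∃ l : ℝ, 0 ≤ l ∧
      Filter.Tendsto (fun i => h0theta (L i)) Filter.atTop (nhds l) ∧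
      ∀ k, l ≤ h0theta (L k) + ∑' j : ℕ, h0thetaKer (L (k + j + 1)) (q (k + j)) := by
  exact limit_real (fun i => h0theta (L i)) (fun i => h0thetaKer (L (i + 1)) (q i))
    (fun i => h0theta_nonneg _ (hdisc i)) (fun i => h0thetaKer_nonneg _ _ (hdisc (i + 1)))
    (fun i => subadd _ _ _ (hdisc (i + 1)) (hdisc i) (hmap i) (hsurj i) (hcontr i) (hlift i)) hsum
end
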